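/- Let p ≥ 2 be an integer modulus and P ∈ ℕ a precision. If x_1, …, x_m ∈ ℚ satisfy 10^P · x_i ∈ ℤ for every i, then the encoding is additively homomorphic: enc(x_1 + ⋯ + x_m) = enc(x_1) + ⋯ + enc(x_m) in ZMod p; moreover, if additionally |10^P · (x_1 + ⋯ + x_m)| < p/2, then dec(enc(x_1) + ⋯ + enc(x_m)) = x_1 + ⋯ + x_m. -/

import Mathlib

/-- The fixed-point encoding `enc(x) = int(10^P · x) mod p` into `ZMod p`. -/
noncomputable def enc (p P : ℕ) (x : ℝ) : ZMod p :=
  ((⌊(10 : ℝ) ^ P * x⌋ : ℤ) : ZMod p)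

/-- The decoding `dec(z) = v / 10^P` if `v ≤ p/2` and `(v - p) / 10^P`
otherwise, where `v ∈ {0, …, p-1}` is the canonical representative of `z`. -/
noncomputable def dec (p P : ℕ) (z : ZMod p) : ℝ :=
  if (z.val : ℝ) ≤ (p : ℝ) / 2 then (z.val : ℝ) / 10 ^ P
  else ((z.val : ℝ) - (p : ℝ)) / 10 ^ P

/-- A real number whose scaling by `10 ^ P` is the integer `k` is encoded as `k mod p`. -/
lemma enc_eq_intCast {p P : ℕ} {x : ℝ} {k : ℤ} (h : (10 : ℝ) ^ P * x = k) :
    enc p P x = (k : ZMod p) := by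
  rw [enc, h, Int.floor_intCast]

/-- Decoding divides the representative of least absolute value by `10 ^ P`. -/
lemma dec_eq_valMinAbs_div (p P : ℕ) [NeZero p] (z : ZMod p) :
    dec p P z = (z.valMinAbs : ℝ) / 10 ^ P := by
  have hiff : (z.val : ℝ) ≤ (p : ℝ) / 2 ↔ z.val ≤ p / 2 := by
    rw [Nat.le_div_iff_mul_le two_pos, le_div_iff₀ two_pos]
    norm_cast
  rw [dec, ZMod.valMinAbs_def_pos]
  simp only [hiff]
  split_ifs <;> push_cast <;> rfl

/-- Decoding the class of an integer of absolute value less than `p / 2` recovers that integer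
divided by `10 ^ P`. -/
lemma dec_intCast {p P : ℕ} [NeZero p] {k : ℤ} (hk : 2 * |k| < p) :
    dec p P (k : ZMod p) = (k : ℝ) / 10 ^ P := by
  have hval : (k : ZMod p).valMinAbs = k := by
    rw [ZMod.valMinAbs_spec]
    refine ⟨rfl, ?_, ?_⟩
    · linarith [neg_abs_le k]
    · linarith [le_abs_self k]
  rw [dec_eq_valMinAbs_div, hval]

/-- **Additive homomorphism of the encoding.**
Let `p ≥ 2` and `P` a precision. If `x 0, …, x (m-1) : ℚ` are such that each
`10^P · x i` is an integer, then
`enc (x 0 + ⋯ + x (m-1)) = enc (x 0) + ⋯ + enc (x (m-1))` in `ZMod p`;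
moreover, if additionally `|10^P · (x 0 + ⋯ + x (m-1))| < p/2`, then
`dec (enc (x 0) + ⋯ + enc (x (m-1))) = x 0 + ⋯ + x (m-1)`. -/
theorem enc_additively_homomorphic
    (p P m : ℕ) (hp : 2 ≤ p) (x : Fin m → ℚ)
    (hint : ∀ i : Fin m, ∃ k : ℤ, (10 : ℚ) ^ P * x i = (k : ℚ)) :
    enc p P ((∑ i : Fin m, x i : ℚ) : ℝ) = ∑ i : Fin m, enc p P ((x i : ℚ) : ℝ) ∧
    (|(10 : ℚ) ^ P * ∑ i : Fin m, x i| < (p : ℚ) / 2 →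
      dec p P (∑ i : Fin m, enc p P ((x i : ℚ) : ℝ)) =
        ((∑ i : Fin m, x i : ℚ) : ℝ)) := by
  have : NeZero p := ⟨by omega⟩
  choose k hk using hint
  have hsum : (10 : ℚ) ^ P * ∑ i, x i = ((∑ i, k i : ℤ) : ℚ) := by
    rw [Finset.mul_sum, Int.cast_sum]
    exact Finset.sum_congr rfl fun i _ => hk i
  have hsumReal : (10 : ℝ) ^ P * ((∑ i, x i : ℚ) : ℝ) = ((∑ i, k i : ℤ) : ℝ) := by
    exact_mod_cast hsum
  have hterm (i : Fin m) : enc p P (x i : ℝ) = (k i : ZMod p) :=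
    enc_eq_intCast (by exact_mod_cast hk i)
  have henc : ∑ i, enc p P (x i : ℝ) = ((∑ i, k i : ℤ) : ZMod p) := by
    rw [Int.cast_sum]
    exact Finset.sum_congr rfl fun i _ => hterm i
  refine ⟨(enc_eq_intCast hsumReal).trans henc.symm, fun hlt => ?_⟩
  rw [hsum, lt_div_iff₀ two_pos, mul_comm] at hlt
  rw [henc, dec_intCast (by exact_mod_cast hlt), ← hsumReal]
  exact mul_div_cancel_left₀ _ (by positivity)
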